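/- The equality case of Brunn-Minkowski: if A and B are convex bodies in ℝ^n of positive volume with |A+B|^{1/n} = |A|^{1/n} + |B|^{1/n}, then A and B are homothetic, i.e. there exist c > 0 and d ∈ ℝ^n with B = cA + d. -/

import Mathlib

open MeasureTheory Metric Set Filter
open scoped RealInnerProductSpace NNReal ENNReal Pointwise Topology

/-- The support function of a set `A ⊆ ℝⁿ`: `h_A(ξ) = sup_{ζ ∈ A} ⟨ζ, ξ⟩`. -/
noncomputable def suppFn {n : ℕ} (A : Set (EuclideanSpace ℝ (Fin n)))
    (ξ : EuclideanSpace ℝ (Fin n)) : ℝ :=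
  sSup ((fun ζ => ⟪ζ, ξ⟫) '' A)

lemma bm1_compact (K L : Set ℝ) (hK : IsCompact K) (hL : IsCompact L) (hKn : K.Nonempty)
    (hLn : L.Nonempty) : volume K + volume L ≤ volume (K + L) := by
  obtain ⟨k, hk, hkm⟩ := hK.exists_isGreatest hKn
  obtain ⟨l, hl, hlm⟩ := hL.exists_isLeast hLn
  have h1 : volume K = volume ((fun x => x + l) '' K) := by
    simp [image_add_right, measure_preimage_add_right]
  have h2 : volume L = volume ((fun x => k + x) '' L) := by
    simp [image_add_left, measure_preimage_add]
  have hm : MeasurableSet ((fun x => k + x) '' L) :=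
    (hL.image (by fun_prop)).measurableSet
  have hd : volume (((fun x => x + l) '' K) ∩ ((fun x => k + x) '' L)) = 0 := by
    refine measure_mono_null (t := {k + l}) ?_ (by simp)
    rintro _ ⟨⟨x, hx, rfl⟩, ⟨y, hy, hxy⟩⟩
    have := hkm hx
    have := hlm hy
    simp only [mem_singleton_iff] at *
    linarith
  rw [h1, h2, ← measure_union_add_inter _ hm, hd, add_zero]
  apply measure_mono
  rintro _ (⟨x, hx, rfl⟩ | ⟨x, hx, rfl⟩)
  · exact add_mem_add hx hl
  · exact add_mem_add hk hx

lemma bm1_meas (K L C : Set ℝ) (hK : MeasurableSet K) (hL : MeasurableSet L) (hKn : K.Nonempty)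
    (hLn : L.Nonempty) (hC : K + L ⊆ C) : volume K + volume L ≤ volume C := by
  have key : ∀ K' ⊆ K, IsCompact K' → ∀ L' ⊆ L, IsCompact L' →
      volume K' + volume L' ≤ volume C := by
    intro K' hK' hKc L' hL' hLc
    obtain ⟨k, hk⟩ := hKn
    obtain ⟨l, hl⟩ := hLn
    calc volume K' + volume L' ≤ volume (insert k K') + volume (insert l L') := by
          gcongr <;> exact subset_insert _ _
      _ ≤ volume (insert k K' + insert l L') :=
          bm1_compact _ _ (hKc.insert k) (hLc.insert l) (insert_nonempty _ _) (insert_nonempty _ _)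
      _ ≤ volume C := by
          apply measure_mono
          exact (add_subset_add (insert_subset hk hK') (insert_subset hl hL')).trans hC
  rcases eq_or_ne (volume K) 0 with hK0 | hK0
  · rw [hK0, zero_add, hL.measure_eq_iSup_isCompact]
    exact iSup_le fun L' => iSup_le fun hL' => iSup_le fun hLc =>
      by simpa using key ∅ (empty_subset _) isCompact_empty L' hL' hLc
  rcases eq_or_ne (volume L) 0 with hL0 | hL0
  · rw [hL0, add_zero, hK.measure_eq_iSup_isCompact]
    exact iSup_le fun L' => iSup_le fun hL' => iSup_le fun hLc =>
      by simpa using key L' hL' hLc ∅ (empty_subset _) isCompact_empty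
  by_contra hcon
  obtain ⟨r, hr, s, hs, hrs⟩ := ENNReal.exists_lt_add_of_lt_add (not_le.1 hcon) hK0 hL0
  obtain ⟨K', hK', hKc, hrK⟩ := hK.exists_lt_isCompact hr
  obtain ⟨L', hL', hLc, hrL⟩ := hL.exists_lt_isCompact hs
  exact absurd hrs (not_lt.2 ((add_le_add hrK.le hrL.le).trans (key K' hK' hKc L' hL' hLc)))

lemma amgm (θ : ℝ) (h0 : 0 < θ) (h1 : θ < 1) (X Y : ℝ≥0∞) :
    X ^ (1 - θ) * Y ^ θ ≤ ENNReal.ofReal (1 - θ) * X + ENNReal.ofReal θ * Y := by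
  by_cases hX : X = ⊤
  · subst hX
    rw [ENNReal.mul_top (by simpa using h1)]; simp
  by_cases hY : Y = ⊤
  · subst hY
    rw [ENNReal.mul_top (a := ENNReal.ofReal θ) (by simpa using h0)]; simp
  lift X to ℝ≥0 using hX
  lift Y to ℝ≥0 using hY
  have := NNReal.geom_mean_le_arith_mean2_weighted (Real.toNNReal (1-θ)) (Real.toNNReal θ) X Y
    (by rw [← Real.toNNReal_add (by linarith) h0.le]; simp)
  rw [Real.coe_toNNReal _ (by linarith), Real.coe_toNNReal _ h0.le] at this
  rw [← ENNReal.coe_rpow_of_nonneg _ (by linarith), ← ENNReal.coe_rpow_of_nonneg _ h0.le]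
  unfold ENNReal.ofReal
  exact_mod_cast this

lemma pl1_norm (θ : ℝ) (h0 : 0 < θ) (h1 : θ < 1) (f g h : ℝ → ℝ) (hf : Measurable f)
    (hg : Measurable g) (hh : Measurable h) (hf0 : ∀ x, 0 ≤ f x) (hg0 : ∀ x, 0 ≤ g x)
    (hh0 : ∀ x, 0 ≤ h x) (hf1 : ∀ x, f x ≤ 1) (hg1 : ∀ x, g x ≤ 1)
    (hfs : ∀ t < 1, ∃ x, t < f x) (hgs : ∀ t < 1, ∃ x, t < g x)
    (H : ∀ t x y, 0 < t → t < f x → t < g y → t < h ((1 - θ) * x + θ * y)) :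
    ENNReal.ofReal (1 - θ) * (∫⁻ x, ENNReal.ofReal (f x)) +
      ENNReal.ofReal θ * (∫⁻ x, ENNReal.ofReal (g x)) ≤ ∫⁻ x, ENNReal.ofReal (h x) := by
  rw [lintegral_eq_lintegral_meas_lt _ (.of_forall hf0) hf.aemeasurable,
    lintegral_eq_lintegral_meas_lt _ (.of_forall hg0) hg.aemeasurable,
    lintegral_eq_lintegral_meas_lt _ (.of_forall hh0) hh.aemeasurable]
  have mf : Measurable (fun t : ℝ => volume {a | t < f a}) :=
    Antitone.measurable (fun s t hst => measure_mono fun x hx => lt_of_le_of_lt hst hx)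
  have mg : Measurable (fun t : ℝ => volume {a | t < g a}) :=
    Antitone.measurable (fun s t hst => measure_mono fun x hx => lt_of_le_of_lt hst hx)
  rw [← lintegral_const_mul _ mf, ← lintegral_const_mul _ mg,
    ← lintegral_add_left (by fun_prop)]
  apply setLIntegral_mono' measurableSet_Ioi
  intro t ht
  by_cases ht1 : t < 1
  · have hs : ∀ (c : ℝ) (_ : 0 < c) (S : Set ℝ), ENNReal.ofReal c * volume S = volume (c • S) := by
      intro c hc S
      simp [Measure.addHaar_smul, abs_of_pos hc]
    rw [hs _ (by linarith), hs _ h0]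
    apply bm1_meas
    · exact (measurableSet_lt measurable_const hf).const_smul₀ _
    · exact (measurableSet_lt measurable_const hg).const_smul₀ _
    · exact Set.Nonempty.smul_set (hfs t ht1)
    · exact Set.Nonempty.smul_set (hgs t ht1)
    · rintro _ ⟨_, ⟨x, hx, rfl⟩, _, ⟨y, hy, rfl⟩, rfl⟩
      exact H t x y ht hx hy
  · have e1 : {a | t < f a} = ∅ := by
      ext x; simp; linarith [hf1 x]
    have e2 : {a | t < g a} = ∅ := by
      ext x; simp; linarith [hg1 x]
    simp [e1, e2]

lemma pl1_bdd (θ : ℝ) (h0 : 0 < θ) (h1 : θ < 1) (f g h : ℝ → ℝ≥0∞) (hf : Measurable f)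
    (hg : Measurable g) (hh : Measurable h) (M N : ℝ≥0) (hM : ∀ x, f x ≤ M) (hN : ∀ x, g x ≤ N)
    (H : ∀ x y, f x ^ (1 - θ) * g y ^ θ ≤ h ((1 - θ) * x + θ * y)) :
    (∫⁻ x, f x) ^ (1 - θ) * (∫⁻ x, g x) ^ θ ≤ ∫⁻ x, h x := by
  have h1' : 0 < 1 - θ := by linarith
  set a := ⨆ x, f x with ha
  set b := ⨆ x, g x with hb
  have haf : ∀ x, f x ≤ a := le_iSup f
  have hbg : ∀ x, g x ≤ b := le_iSup g
  have haT : a ≠ ⊤ := ne_top_of_le_ne_top ENNReal.coe_ne_top (iSup_le hM)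
  have hbT : b ≠ ⊤ := ne_top_of_le_ne_top ENNReal.coe_ne_top (iSup_le hN)
  by_cases ha0 : a = 0
  · have : ∀ x, f x = 0 := fun x => le_antisymm (ha0 ▸ haf x) bot_le
    simp [this, ENNReal.zero_rpow_of_pos h1']
  by_cases hb0 : b = 0
  · have : ∀ x, g x = 0 := fun x => le_antisymm (hb0 ▸ hbg x) bot_le
    simp [this, ENNReal.zero_rpow_of_pos h0]
  set k := a ^ (1 - θ) * b ^ θ with hk
  have hk0 : k ≠ 0 := by
    simp [hk, ENNReal.rpow_eq_zero_iff, ha0, hb0, haT, hbT]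
  have hkT : k ≠ ⊤ := ENNReal.mul_ne_top (ENNReal.rpow_ne_top_of_nonneg h1'.le haT)
    (ENNReal.rpow_ne_top_of_nonneg h0.le hbT)
  have hfa : ∀ x, f x / a ≤ 1 := fun x => ENNReal.div_le_of_le_mul (by simpa using haf x)
  have hgb : ∀ x, g x / b ≤ 1 := fun x => ENNReal.div_le_of_le_mul (by simpa using hbg x)
  have key := pl1_norm θ h0 h1 (fun x => (f x / a).toReal) (fun x => (g x / b).toReal)
    (fun x => (min (h x / k) 1).toReal) (by fun_prop) (by fun_prop) (by fun_prop)
    (fun _ => ENNReal.toReal_nonneg) (fun _ => ENNReal.toReal_nonneg)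
    (fun _ => ENNReal.toReal_nonneg)
    (fun x => ENNReal.toReal_le_of_le_ofReal zero_le_one (by simpa using hfa x))
    (fun x => ENNReal.toReal_le_of_le_ofReal zero_le_one (by simpa using hgb x))
    ?_ ?_ ?_
  · have e : ∀ y : ℝ≥0∞, y ≤ 1 → ENNReal.ofReal y.toReal = y := fun y hy =>
      ENNReal.ofReal_toReal (ne_top_of_le_ne_top ENNReal.one_ne_top hy)
    simp only [e _ (hfa _), e _ (hgb _), e _ (min_le_right _ _)] at key
    have key2 := (amgm θ h0 h1 _ _).trans (key.trans (lintegral_mono (fun x => min_le_left _ _)))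
    simp only [div_eq_mul_inv] at key2
    rw [lintegral_mul_const _ hf, lintegral_mul_const _ hg, lintegral_mul_const _ hh,
      ENNReal.mul_rpow_of_nonneg _ _ h1'.le, ENNReal.mul_rpow_of_nonneg _ _ h0.le] at key2
    have hkk : k⁻¹ = a⁻¹ ^ (1 - θ) * b⁻¹ ^ θ := by
      rw [hk, ENNReal.mul_inv, ENNReal.inv_rpow, ENNReal.inv_rpow]
      · left; simp [ENNReal.rpow_eq_zero_iff, ha0, haT]
      · left; exact (ENNReal.rpow_ne_top_of_nonneg h1'.le haT)
    rw [mul_mul_mul_comm, ← hkk] at key2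
    rwa [ENNReal.mul_le_mul_iff_left (by simp [hkT]) (by simp [hk0])] at key2
  · intro t ht
    by_cases ht0 : t < 0
    · exact ⟨0, ht0.trans_le ENNReal.toReal_nonneg⟩
    have : ENNReal.ofReal t * a < a := by
      conv_rhs => rw [← one_mul a]
      rw [ENNReal.mul_lt_mul_iff_left ha0 haT]; simpa using ht
    obtain ⟨x, hx⟩ := lt_iSup_iff.1 (this.trans_eq ha)
    refine ⟨x, ?_⟩
    rw [← ENNReal.ofReal_lt_iff_lt_toReal (not_lt.1 ht0) (ne_top_of_le_ne_top ENNReal.one_ne_top (hfa x))]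
    rwa [ENNReal.lt_div_iff_mul_lt (by simp [ha0]) (by simp [haT])]
  · intro t ht
    by_cases ht0 : t < 0
    · exact ⟨0, ht0.trans_le ENNReal.toReal_nonneg⟩
    have : ENNReal.ofReal t * b < b := by
      conv_rhs => rw [← one_mul b]
      rw [ENNReal.mul_lt_mul_iff_left hb0 hbT]; simpa using ht
    obtain ⟨x, hx⟩ := lt_iSup_iff.1 (this.trans_eq hb)
    refine ⟨x, ?_⟩
    rw [← ENNReal.ofReal_lt_iff_lt_toReal (not_lt.1 ht0) (ne_top_of_le_ne_top ENNReal.one_ne_top (hgb x))]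
    rwa [ENNReal.lt_div_iff_mul_lt (by simp [hb0]) (by simp [hbT])]
  · intro t x y ht hx hy
    have hfT := ne_top_of_le_ne_top ENNReal.one_ne_top (hfa x)
    have hgT := ne_top_of_le_ne_top ENNReal.one_ne_top (hgb y)
    rw [← ENNReal.ofReal_lt_iff_lt_toReal ht.le hfT] at hx
    rw [← ENNReal.ofReal_lt_iff_lt_toReal ht.le hgT] at hy
    rw [← ENNReal.ofReal_lt_iff_lt_toReal ht.le (ne_top_of_le_ne_top ENNReal.one_ne_top (min_le_right _ _))]
    refine lt_min ?_ (hx.trans_le (hfa x))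
    refine (lt_min hx hy).trans_le ?_
    set m := min (f x / a) (g y / b) with hm
    have hm0 : m ≠ 0 := ((bot_le).trans_lt (lt_min hx hy)).ne'
    have hmT : m ≠ ⊤ := ne_top_of_le_ne_top hfT (min_le_left _ _)
    calc m = m ^ (1 - θ) * m ^ θ := by
          rw [← ENNReal.rpow_add _ _ hm0 hmT]; simp
      _ ≤ (f x / a) ^ (1 - θ) * (g y / b) ^ θ := by
          gcongr
          · exact min_le_left _ _
          · exact min_le_right _ _
      _ = (f x ^ (1 - θ) * g y ^ θ) / k := by
          rw [ENNReal.div_rpow_of_nonneg _ _ h1'.le, ENNReal.div_rpow_of_nonneg _ _ h0.le, hk,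
            div_eq_mul_inv, div_eq_mul_inv, div_eq_mul_inv, ENNReal.mul_inv, mul_mul_mul_comm]
          · left; simp [ENNReal.rpow_eq_zero_iff, ha0, haT]
          · left; exact (ENNReal.rpow_ne_top_of_nonneg h1'.le haT)
      _ ≤ _ := by gcongr; exact H x y

lemma lint_trunc (f : ℝ → ℝ≥0∞) (hf : Measurable f) :
    ∫⁻ x, f x = ⨆ n : ℕ, ∫⁻ x, min (f x) ((n : ℝ≥0) : ℝ≥0∞) := by
  rw [← lintegral_iSup]
  · congr 1; ext x
    refine le_antisymm ?_ (iSup_le fun n => min_le_left _ _)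
    refine le_of_forall_lt fun c hc => ?_
    obtain ⟨n, hn⟩ := ENNReal.exists_nat_gt hc.ne_top
    refine lt_of_lt_of_le (lt_min hc hn) ?_
    exact le_iSup (fun n : ℕ => min (f x) ((n : ℝ≥0) : ℝ≥0∞)) n
  · intro n; fun_prop
  · intro m n hmn x
    simp only
    gcongr

lemma pl1 (θ : ℝ) (h0 : 0 < θ) (h1 : θ < 1) (f g h : ℝ → ℝ≥0∞) (hf : Measurable f)
    (hg : Measurable g) (hh : Measurable h)
    (H : ∀ x y, f x ^ (1 - θ) * g y ^ θ ≤ h ((1 - θ) * x + θ * y)) :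
    (∫⁻ x, f x) ^ (1 - θ) * (∫⁻ x, g x) ^ θ ≤ ∫⁻ x, h x := by
  have h1' : 0 < 1 - θ := by linarith
  rw [lint_trunc f hf, lint_trunc g hg]
  have e1 := (ENNReal.orderIsoRpow (1 - θ) h1').map_iSup
    (fun n : ℕ => ∫⁻ x, min (f x) ((n : ℝ≥0) : ℝ≥0∞))
  have e2 := (ENNReal.orderIsoRpow θ h0).map_iSup
    (fun n : ℕ => ∫⁻ x, min (g x) ((n : ℝ≥0) : ℝ≥0∞))
  simp only [ENNReal.orderIsoRpow_apply] at e1 e2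
  rw [e1, e2, ENNReal.iSup_mul]
  refine iSup_le fun m => ?_
  rw [ENNReal.mul_iSup]
  refine iSup_le fun n => ?_
  refine pl1_bdd θ h0 h1 _ _ h (by fun_prop) (by fun_prop) hh m n (fun x => min_le_right _ _)
    (fun x => min_le_right _ _) fun x y => ?_
  refine le_trans ?_ (H x y)
  gcongr <;> exact min_le_left _ _

lemma pln (θ : ℝ) (h0 : 0 < θ) (h1 : θ < 1) (n : ℕ) : ∀ (f g h : (Fin n → ℝ) → ℝ≥0∞)
    (_ : Measurable f) (_ : Measurable g) (_ : Measurable h)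
    (_ : ∀ x y, f x ^ (1 - θ) * g y ^ θ ≤ h ((1 - θ) • x + θ • y)),
    (∫⁻ x, f x) ^ (1 - θ) * (∫⁻ x, g x) ^ θ ≤ ∫⁻ x, h x := by
  induction n with
  | zero =>
    intro f g h hf hg hh H
    have hv : (volume : Measure (Fin 0 → ℝ)) univ = 1 := by
      simp [volume_pi]
    rw [lintegral_unique, lintegral_unique, lintegral_unique, hv]
    simp only [mul_one]
    convert H default default
  | succ n ih =>
    intro f g h hf hg hh H
    set e := (MeasurableEquiv.piFinSuccAbove (fun _ : Fin (n+1) => ℝ) 0).symm with he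
    have hmp : MeasurePreserving e volume volume :=
      (volume_preserving_piFinSuccAbove (fun _ : Fin (n+1) => ℝ) 0).symm _
    have hem : Measurable e := e.measurable
    have hI : ∀ f : (Fin (n+1) → ℝ) → ℝ≥0∞, Measurable f →
        ∫⁻ x, f x = ∫⁻ s : ℝ, ∫⁻ y : Fin n → ℝ, f (e (s, y)) := by
      intro f hf
      rw [← hmp.lintegral_comp hf, Measure.volume_eq_prod, lintegral_prod]
      exact (hf.comp hem).aemeasurable
    have hlin : ∀ s t x y, e ((1 - θ) * s + θ * t, (1 - θ) • x + θ • y)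
        = (1 - θ) • e (s, x) + θ • e (t, y) := by
      intro s t x y
      ext i
      refine Fin.cases ?_ (fun j => ?_) i <;>
      simp [he, MeasurableEquiv.piFinSuccAbove, Fin.insertNthEquiv]
    rw [hI f hf, hI g hg, hI h hh]
    refine pl1 θ h0 h1 _ _ _ ?_ ?_ ?_ ?_
    · exact Measurable.lintegral_prod_right (hf.comp hem)
    · exact Measurable.lintegral_prod_right (hg.comp hem)
    · exact Measurable.lintegral_prod_right (hh.comp hem)
    · intro s t
      refine ih _ _ _ (by fun_prop) (by fun_prop) (by fun_prop) ?_
      intro x y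
      rw [hlin]
      exact H _ _

lemma bm {n : ℕ} (θ : ℝ) (h0 : 0 < θ) (h1 : θ < 1) (K L C : Set (EuclideanSpace ℝ (Fin n)))
    (hK : IsCompact K) (hL : IsCompact L) (hC : IsCompact C) 
    (H : ∀ x ∈ K, ∀ y ∈ L, (1 - θ) • x + θ • y ∈ C) :
    (volume.real K) ^ (1 - θ) * (volume.real L) ^ θ ≤ volume.real C := by
  have h1' : 0 < 1 - θ := by linarith
  have hmp := PiLp.volume_preserving_toLp (Fin n)
  have hI : ∀ S : Set (EuclideanSpace ℝ (Fin n)), MeasurableSet S →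
      volume S = ∫⁻ x : Fin n → ℝ, S.indicator 1 (WithLp.toLp 2 x : EuclideanSpace ℝ (Fin n)) := by
    intro S hS
    rw [hmp.lintegral_comp (f := S.indicator 1) (measurable_one.indicator hS),
      lintegral_indicator_one hS]
  have key := pln θ h0 h1 n (fun x => K.indicator 1 (WithLp.toLp 2 x : EuclideanSpace ℝ (Fin n)))
    (fun x => L.indicator 1 (WithLp.toLp 2 x : EuclideanSpace ℝ (Fin n)))
    (fun x => C.indicator 1 (WithLp.toLp 2 x : EuclideanSpace ℝ (Fin n)))
    ((measurable_one.indicator hK.measurableSet).comp hmp.measurable)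
    ((measurable_one.indicator hL.measurableSet).comp hmp.measurable)
    ((measurable_one.indicator hC.measurableSet).comp hmp.measurable) ?_
  · rw [← hI K hK.measurableSet, ← hI L hL.measurableSet, ← hI C hC.measurableSet] at key
    have := ENNReal.toReal_mono hC.measure_ne_top key
    simpa [ENNReal.toReal_mul, ← ENNReal.toReal_rpow, Measure.real] using this
  · intro x y
    by_cases hx : (WithLp.toLp 2 x : EuclideanSpace ℝ (Fin n)) ∈ K
    · by_cases hy : (WithLp.toLp 2 y : EuclideanSpace ℝ (Fin n)) ∈ L
      · have := H _ hx _ hy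
        rw [indicator_of_mem hx, indicator_of_mem hy, indicator_of_mem (by simpa using this)]
        simp
      · rw [indicator_of_notMem hy]; simp [ENNReal.zero_rpow_of_pos h0]
    · rw [indicator_of_notMem hx]; simp [ENNReal.zero_rpow_of_pos h1']

lemma sqbound (a b c X : ℝ) (hc : 0 < c) (ha : c ≤ a) (hb : c ≤ b) (hX : 0 ≤ X)
    (h : a * b ≤ X ^ 2) : (a + b) / 2 - (a - b) ^ 2 / (4 * c) ≤ X := by
  set e := (a - b) ^ 2 / (4 * c) with he
  have he0 : 0 ≤ e := by positivity
  have hec : e * (4 * c) = (a - b) ^ 2 := by rw [he]; field_simp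
  by_contra hcon
  push Not at hcon
  have h1 : X ^ 2 < ((a + b) / 2 - e) ^ 2 := by
    apply pow_lt_pow_left₀ hcon hX (by norm_num)
  have h2 : e * c ≤ e * ((a + b) / 2) := mul_le_mul_of_nonneg_left (by linarith) he0
  have h3 : e * e ≤ e * ((a + b) / 2) := mul_le_mul_of_nonneg_left (by linarith) he0
  nlinarith

lemma ivt (F : ℝ → ℝ) (hF : Continuous F) (h0 : Tendsto F atBot (𝓝 0))
    (h1 : Tendsto F atTop (𝓝 1)) (τ : ℝ) (hτ0 : 0 < τ) (hτ1 : τ < 1) : ∃ x, F x = τ := by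
  apply mem_range_of_exists_le_of_exists_ge hF
  · obtain ⟨x, hx⟩ := (h0.eventually (gt_mem_nhds hτ0)).exists
    exact ⟨x, hx.le⟩
  · obtain ⟨x, hx⟩ := (h1.eventually (lt_mem_nhds hτ1)).exists
    exact ⟨x, hx.le⟩

lemma lowerLip (H : ℝ → ℝ) (hH : Continuous H) (hm : Monotone H) (h0 : Tendsto H atBot (𝓝 0))
    (h1 : Tendsto H atTop (𝓝 1))
    (hlc : ∀ x y θ, 0 < θ → θ < 1 → H x ^ (1 - θ) * H y ^ θ ≤ H ((1 - θ) * x + θ * y))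
    (τ0 τ1 : ℝ) (hτ0 : 0 < τ0) (hτ1 : τ1 < 1) (hττ : τ0 ≤ τ1) :
    ∃ κ > 0, ∀ x y, x ≤ y → τ0 ≤ H x → H y ≤ τ1 → κ * (y - x) ≤ H y - H x := by
  obtain ⟨v0, hv0, hv0'⟩ := exists_between hτ1
  obtain ⟨v1, hv1, hv1'⟩ := exists_between hv0'
  obtain ⟨y0, hy0⟩ := ivt H hH h0 h1 v0 (by linarith) hv0'
  obtain ⟨y1, hy1⟩ := ivt H hH h0 h1 v1 (by linarith) hv1'
  have hyy : y0 < y1 := by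
    by_contra hcon
    have := hm (not_lt.1 hcon)
    linarith
  have hconc : ConcaveOn ℝ {x | 0 < H x} (fun x => Real.log (H x)) := by
    refine ⟨?_, ?_⟩
    · have : IsUpperSet {x | 0 < H x} := fun x y hxy hx => lt_of_lt_of_le hx (hm hxy)
      exact this.ordConnected.convex
    · intro x hx y hy a b ha hb hab
      simp only [mem_ofPred_eq] at hx hy
      rcases ha.eq_or_lt with rfl | ha
      · have : b = 1 := by linarith
        simp [this]
      rcases hb.eq_or_lt with rfl | hb
      · have : a = 1 := by linarith
        simp [this]
      have := hlc x y b hb (by linarith)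
      have e : 1 - b = a := by linarith
      rw [e] at this
      have h2 := Real.log_le_log (by positivity) this
      rw [Real.log_mul (by positivity) (by positivity), Real.log_rpow hx, Real.log_rpow hy] at h2
      simpa using h2
  set m := (Real.log (H y1) - Real.log (H y0)) / (y1 - y0) with hmdef
  have hmpos : 0 < m := by
    apply div_pos _ (by linarith)
    rw [hy0, hy1]
    exact sub_pos.2 (Real.log_lt_log (by linarith) hv1)
  refine ⟨m * τ0, by positivity, ?_⟩
  intro x y hxy hx hy
  rcases hxy.eq_or_lt with rfl | hxy
  · simp
  have hyy0 : y < y0 := by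
    by_contra hcon
    have := hm (not_lt.1 hcon)
    linarith
  have hHx : 0 < H x := by linarith
  have hHy : 0 < H y := hHx.trans_le (hm hxy.le)
  have hHy0 : 0 < H y0 := by linarith
  have hHy1 : 0 < H y1 := by linarith
  have s1 := hconc.slope_anti_adjacent (x := x) (y := y) (z := y0) hHx hHy0 hxy hyy0
  have s2 := hconc.slope_anti_adjacent (x := y) (y := y0) (z := y1) hHy hHy1 hyy0 hyy
  have s3 : m ≤ (Real.log (H y) - Real.log (H x)) / (y - x) := s2.trans s1
  rw [le_div_iff₀ (by linarith)] at s3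
  have s4 : Real.log (H y) - Real.log (H x) ≤ H y / H x - 1 := by
    rw [← Real.log_div hHy.ne' hHx.ne']
    exact Real.log_le_sub_one_of_pos (by positivity)
  have s5 : (H y / H x - 1) * H x = H y - H x := by field_simp
  have s6 : m * (y - x) * H x ≤ H y - H x := by
    rw [← s5]; exact mul_le_mul_of_nonneg_right (s3.trans s4) hHx.le
  have s7 : m * (y - x) * τ0 ≤ m * (y - x) * H x :=
    mul_le_mul_of_nonneg_left hx (mul_nonneg hmpos.le (by linarith))
  nlinarith

structure IsCdf (F : ℝ → ℝ) : Prop where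
  cont : Continuous F
  mono : Monotone F
  bot : Tendsto F atBot (𝓝 0)
  top : Tendsto F atTop (𝓝 1)
  nn : ∀ x, 0 ≤ F x
  le1 : ∀ x, F x ≤ 1

lemma stepBound (F G H : ℝ → ℝ) (hH : IsCdf H)
    (h1 : ∀ s t, F s * G t ≤ H ((s + t) / 2) ^ 2)
    (h2 : ∀ s t, (1 - F s) * (1 - G t) ≤ (1 - H ((s + t) / 2)) ^ 2)
    (hlc : ∀ x y θ, 0 < θ → θ < 1 → H x ^ (1 - θ) * H y ^ θ ≤ H ((1 - θ) * x + θ * y))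
    (τ0 τ1 : ℝ) (hτ0 : 0 < τ0) (hτ1 : τ1 < 1) (hττ : τ0 ≤ τ1) :
    ∃ K, ∀ s t s' t' : ℝ, F s = G t → F s' = G t' → τ0 ≤ F s → F s ≤ τ1 → τ0 ≤ F s' → F s' ≤ τ1 →
      |(t' - s') - (t - s)| ≤ K * (F s' - F s) ^ 2 := by
  obtain ⟨κ, hκ, hL⟩ := lowerLip H hH.cont hH.mono hH.bot hH.top hlc τ0 τ1 hτ0 hτ1 hττ
  set K := 1 / (4 * τ0) + 1 / (4 * (1 - τ1)) with hK
  refine ⟨2 * K / κ, ?_⟩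
  intro s t s' t' e e' a1 a2 a3 a4
  have gen : ∀ a b c : ℝ, τ0 ≤ a → a ≤ τ1 → τ0 ≤ b → b ≤ τ1 → a * b ≤ H c ^ 2 →
      (1 - a) * (1 - b) ≤ (1 - H c) ^ 2 → τ0 ≤ H c ∧ H c ≤ τ1 ∧
      (a + b) / 2 - (a - b) ^ 2 / (4 * τ0) ≤ H c ∧
      H c ≤ (a + b) / 2 + (a - b) ^ 2 / (4 * (1 - τ1)) := by
    intro a b c ha ha' hb hb' p q
    have hc0 := hH.nn c
    have hc1 := hH.le1 c
    refine ⟨?_, ?_, sqbound a b τ0 _ hτ0 ha hb hc0 p, ?_⟩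
    · apply (sq_le_sq₀ hτ0.le hc0).1
      nlinarith
    · have : (1 - τ1) ≤ 1 - H c := by
        apply (sq_le_sq₀ (by linarith) (by linarith)).1
        nlinarith
      linarith
    · have := sqbound (1 - a) (1 - b) (1 - τ1) (1 - H c) (by linarith) (by linarith) (by linarith)
        (by linarith) q
      have e : (1 - a - (1 - b)) ^ 2 = (a - b) ^ 2 := by ring
      rw [e] at this
      linarith
  obtain ⟨b1, b2, b3, b4⟩ := gen (F s) (F s') ((s + t') / 2) a1 a2 a3 a4
    (e' ▸ h1 s t') (e' ▸ h2 s t')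
  obtain ⟨c1, c2, c3, c4⟩ := gen (F s') (F s) ((s' + t) / 2) a3 a4 a1 a2
    (e ▸ h1 s' t) (e ▸ h2 s' t)
  have hd : ∀ a b x : ℝ, (a - b) ^ 2 / (4 * x) = (1 / (4 * x)) * (b - a) ^ 2 := by
    intro a b x; ring
  rw [hd] at b3 b4 c3 c4
  have hsw : (F s - F s') ^ 2 = (F s' - F s) ^ 2 := by ring
  rw [hsw] at c3 c4
  have hKe : 2 * K / κ * (F s' - F s) ^ 2 = 2 * (K * (F s' - F s) ^ 2) / κ := by ring
  have hK2 : K * (F s' - F s) ^ 2 = 1 / (4 * τ0) * (F s' - F s) ^ 2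
      + 1 / (4 * (1 - τ1)) * (F s' - F s) ^ 2 := by rw [hK]; ring
  rw [hKe, le_div_iff₀ hκ]
  rcases le_total ((s + t') / 2) ((s' + t) / 2) with hle | hle
  · have := hL _ _ hle b1 c2
    rw [abs_of_nonpos (by linarith)]
    nlinarith
  · have := hL _ _ hle c1 b2
    rw [abs_of_nonneg (by linarith)]
    nlinarith

lemma const_of_sq (w : ℝ → ℝ) (a b K : ℝ) (hab : a ≤ b)
    (h : ∀ x ∈ Icc a b, ∀ y ∈ Icc a b, |w y - w x| ≤ K * (y - x) ^ 2) : w b = w a := by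
  rcases hab.eq_or_lt with rfl | hab
  · rfl
  have hd : ∀ x ∈ Icc a b, HasDerivWithinAt w 0 (Icc a b) x := by
    intro x hx
    rw [hasDerivWithinAt_iff_isLittleO]
    have : (fun y => w y - w x) =O[𝓝[Icc a b] x] (fun y => (y - x) ^ 2) := by
      refine Asymptotics.IsBigO.of_bound K ?_
      filter_upwards [self_mem_nhdsWithin] with y hy
      simpa using h x hx y hy
    simp only [smul_zero, sub_zero]
    refine this.trans_isLittleO ?_
    have h2 : (fun y => (y - x) ^ 2) =o[𝓝 x] (fun y => y - x) := by
      have := (Asymptotics.isLittleO_pow_id (𝕜 := ℝ) (n := 2) (by norm_num))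
      have ht : Tendsto (fun y => y - x) (𝓝 x) (𝓝 0) := by
        have : Tendsto (fun y => y - x) (𝓝 x) (𝓝 (x - x)) := by
          apply Continuous.tendsto; fun_prop
        simpa using this
      exact this.comp_tendsto ht
    exact h2.mono nhdsWithin_le_nhds
  refine constant_of_derivWithin_zero (fun x hx => (hd x hx).differentiableWithinAt) ?_ b
    (right_mem_Icc.2 hab.le)
  intro x hx
  exact (hd x (Ico_subset_Icc_self hx)).derivWithin (uniqueDiffOn_Icc hab x (Ico_subset_Icc_self hx))

lemma oneD (F G H : ℝ → ℝ) (hF : IsCdf F) (hG : IsCdf G) (hH : IsCdf H)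
    (h1 : ∀ s t, F s * G t ≤ H ((s + t) / 2) ^ 2)
    (h2 : ∀ s t, (1 - F s) * (1 - G t) ≤ (1 - H ((s + t) / 2)) ^ 2)
    (hlc : ∀ x y θ, 0 < θ → θ < 1 → H x ^ (1 - θ) * H y ^ θ ≤ H ((1 - θ) * x + θ * y)) :
    ∃ d, ∀ s, G (s + d) = F s := by
  have key := stepBound F G H hH h1 h2 hlc
  have hp : ∀ τ : ℝ, ∃ x, 0 < τ → τ < 1 → F x = τ := by
    intro τ
    by_cases h : 0 < τ ∧ τ < 1
    · obtain ⟨x, hx⟩ := ivt F hF.cont hF.bot hF.top τ h.1 h.2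
      exact ⟨x, fun _ _ => hx⟩
    · exact ⟨0, fun a b => absurd ⟨a, b⟩ h⟩
  have hq : ∀ τ : ℝ, ∃ x, 0 < τ → τ < 1 → G x = τ := by
    intro τ
    by_cases h : 0 < τ ∧ τ < 1
    · obtain ⟨x, hx⟩ := ivt G hG.cont hG.bot hG.top τ h.1 h.2
      exact ⟨x, fun _ _ => hx⟩
    · exact ⟨0, fun a b => absurd ⟨a, b⟩ h⟩
  choose p hp using hp
  choose q hq using hq
  have hw : ∀ a b, 0 < a → b < 1 → a ≤ b → q b - p b = q a - p a := by
    intro a b ha hb hab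
    obtain ⟨K, hK⟩ := key a b ha hb hab
    refine const_of_sq (fun τ => q τ - p τ) a b K hab ?_
    intro x hx y hy
    have e1 := hp x (ha.trans_le hx.1) (hx.2.trans_lt hb)
    have e2 := hq x (ha.trans_le hx.1) (hx.2.trans_lt hb)
    have e3 := hp y (ha.trans_le hy.1) (hy.2.trans_lt hb)
    have e4 := hq y (ha.trans_le hy.1) (hy.2.trans_lt hb)
    have := hK (p x) (q x) (p y) (q y) (by rw [e1, e2]) (by rw [e3, e4])
      (by rw [e1]; exact hx.1) (by rw [e1]; exact hx.2) (by rw [e3]; exact hy.1)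
      (by rw [e3]; exact hy.2)
    rwa [e1, e3] at this
  set d := q (1/2) - p (1/2) with hd
  have hw' : ∀ τ, 0 < τ → τ < 1 → q τ - p τ = d := by
    intro τ h0 h1
    rcases le_total τ (1/2) with h | h
    · exact (hw τ (1/2) h0 (by norm_num) h).symm
    · exact hw (1/2) τ (by norm_num) h1 h
  refine ⟨d, fun s => ?_⟩
  rcases (hF.nn s).eq_or_lt with h0 | h0
  · rw [← h0]
    by_contra hne
    have hpos := (hG.nn (s + d)).lt_of_ne (Ne.symm hne)
    obtain ⟨τ, hτ0, hτ1⟩ := exists_between hpos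
    have hτ2 := hτ1.trans_le (hG.le1 _)
    have a1 : s < p τ := by
      by_contra hcon
      have := hF.mono (not_lt.1 hcon)
      rw [hp τ hτ0 hτ2] at this
      linarith
    have a2 : q τ < s + d := by
      by_contra hcon
      have := hG.mono (not_lt.1 hcon)
      rw [hq τ hτ0 hτ2] at this
      linarith
    linarith [hw' τ hτ0 hτ2]
  rcases (hF.le1 s).eq_or_lt with h1' | h1'
  · rw [h1']
    by_contra hne
    have hpos := (hG.le1 (s + d)).lt_of_ne hne
    obtain ⟨τ, hτ0, hτ1⟩ := exists_between hpos
    have hτ2 := (hG.nn _).trans_lt hτ0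
    have a1 : p τ < s := by
      by_contra hcon
      have := hF.mono (not_lt.1 hcon)
      rw [hp τ hτ2 hτ1] at this
      linarith
    have a2 : s + d < q τ := by
      by_contra hcon
      have := hG.mono (not_lt.1 hcon)
      rw [hq τ hτ2 hτ1] at this
      linarith
    linarith [hw' τ hτ2 hτ1]
  · obtain ⟨K, hK⟩ := key (F s) (F s) h0 h1' le_rfl
    have e1 := hp (F s) h0 h1'
    have e2 := hq (F s) h0 h1'
    have := hK (p (F s)) (q (F s)) s (q (F s)) (by rw [e1, e2]) e2.symm (by rw [e1]) (by rw [e1]) le_rfl le_rfl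
    rw [e1] at this
    have h3 : |q (F s) - s - (q (F s) - p (F s))| = 0 := le_antisymm (by simpa using this) (abs_nonneg _)
    rw [abs_eq_zero] at h3
    have h4 := hw' (F s) h0 h1'
    have : s + d = q (F s) := by linarith
    rw [this, e2]

lemma bm_half {n : ℕ} (K L C : Set (EuclideanSpace ℝ (Fin n)))
    (hK : IsCompact K) (hL : IsCompact L) (hC : IsCompact C)
    (H : ∀ x ∈ K, ∀ y ∈ L, (1 / 2 : ℝ) • x + (1 / 2 : ℝ) • y ∈ C) :
    volume.real K * volume.real L ≤ volume.real C ^ 2 := by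
  have := bm (1/2) (by norm_num) (by norm_num) K L C hK hL hC (by
    intro x hx y hy
    have e : (1 - 1 / 2 : ℝ) = 1 / 2 := by norm_num
    rw [e]; exact H x hx y hy)
  have e : (1 - 1 / 2 : ℝ) = 1 / 2 := by norm_num
  rw [e, ← Real.sqrt_eq_rpow, ← Real.sqrt_eq_rpow, ← Real.sqrt_mul measureReal_nonneg] at this
  exact (Real.sqrt_le_left measureReal_nonneg).1 this

lemma hyper_null {n : ℕ} (u : EuclideanSpace ℝ (Fin n)) (hu : u ≠ 0) (c : ℝ) :
    volume {x : EuclideanSpace ℝ (Fin n) | ⟪x, u⟫ = c} = 0 := by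
  rcases eq_empty_or_nonempty {x : EuclideanSpace ℝ (Fin n) | ⟪x, u⟫ = c} with h | ⟨x0, hx0⟩
  · simp [h]
  have e : {x : EuclideanSpace ℝ (Fin n) | ⟪x, u⟫ = c}
      = (fun x => x + (-x0)) ⁻¹' ((ℝ ∙ u)ᗮ : Submodule ℝ (EuclideanSpace ℝ (Fin n))) := by
    ext x
    have hx0' : ⟪x0, u⟫ = c := hx0
    simp only [mem_ofPred_eq, mem_preimage, SetLike.mem_coe,
      Submodule.mem_orthogonal_singleton_iff_inner_left, inner_add_left, inner_neg_left, hx0']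
    constructor <;> intro h <;> linarith
  rw [e, measure_preimage_add_right]
  apply Measure.addHaar_submodule
  intro htop
  have : u ∈ ((ℝ ∙ u)ᗮ : Submodule ℝ (EuclideanSpace ℝ (Fin n))) := by rw [htop]; trivial
  rw [Submodule.mem_orthogonal_singleton_iff_inner_left, inner_self_eq_zero] at this
  exact hu this

lemma pushprob {n : ℕ} (A : Set (EuclideanSpace ℝ (Fin n))) (hA1 : volume A = 1)
    (u : EuclideanSpace ℝ (Fin n)) :
    IsProbabilityMeasure ((volume.restrict A).map (fun x => ⟪x, u⟫)) := by
  have : IsProbabilityMeasure (volume.restrict A) := ⟨by simpa using hA1⟩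
  exact Measure.isProbabilityMeasure_map (by fun_prop)

lemma push_apply {n : ℕ} (A : Set (EuclideanSpace ℝ (Fin n)))
    (u : EuclideanSpace ℝ (Fin n)) (S : Set ℝ) (hS : MeasurableSet S) :
    ((volume.restrict A).map (fun x => ⟪x, u⟫)).real S
      = volume.real (A ∩ {x | ⟪x, u⟫ ∈ S}) := by
  have hm : Measurable (fun x : EuclideanSpace ℝ (Fin n) => ⟪x, u⟫) := by fun_prop
  rw [Measure.real, Measure.map_apply hm hS, Measure.restrict_apply (hm hS), inter_comm]
  rfl

lemma push_null {n : ℕ} (A : Set (EuclideanSpace ℝ (Fin n)))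
    (u : EuclideanSpace ℝ (Fin n)) (hu : u ≠ 0) (c : ℝ) :
    ((volume.restrict A).map (fun x => ⟪x, u⟫)) {c} = 0 := by
  have hm : Measurable (fun x : EuclideanSpace ℝ (Fin n) => ⟪x, u⟫) := by fun_prop
  rw [Measure.map_apply hm (measurableSet_singleton c)]
  exact le_antisymm ((Measure.restrict_apply_le _ _).trans (hyper_null u hu c).le) bot_le

lemma isCdf_of {μ : Measure ℝ} [IsProbabilityMeasure μ] (h : ∀ c, μ {c} = 0) :
    IsCdf (fun s => μ.real (Iic s)) := by
  have e : (fun s => μ.real (Iic s)) = ProbabilityTheory.cdf μ := by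
    ext s; rw [ProbabilityTheory.cdf_eq_real]
  rw [e]
  refine ⟨?_, ProbabilityTheory.monotone_cdf μ, ProbabilityTheory.tendsto_cdf_atBot μ,
    ProbabilityTheory.tendsto_cdf_atTop μ, ProbabilityTheory.cdf_nonneg μ,
    ProbabilityTheory.cdf_le_one μ⟩
  rw [continuous_iff_continuousAt]
  intro x
  rw [(ProbabilityTheory.monotone_cdf μ).continuousAt_iff_leftLim_eq_rightLim]
  have hs := (ProbabilityTheory.cdf μ).measure_singleton x
  rw [ProbabilityTheory.measure_cdf, h x] at hs
  have h1 := ENNReal.ofReal_eq_zero.1 hs.symm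
  have h2 := (ProbabilityTheory.monotone_cdf μ).leftLim_le (le_refl x)
  rw [StieltjesFunction.rightLim_eq]
  linarith

lemma one_sub_cdf {μ : Measure ℝ} [IsProbabilityMeasure μ] (h : ∀ c, μ {c} = 0) (s : ℝ) :
    1 - μ.real (Iic s) = μ.real (Ici s) := by
  have h1 : μ.real (Ioi s) = 1 - μ.real (Iic s) := by
    rw [← compl_Iic, probReal_compl_eq_one_sub measurableSet_Iic]
  rw [← h1]
  have : NullSingletonClass μ := ⟨h⟩
  exact measureReal_congr Ioi_ae_eq_Ici

lemma dir_shift {n : ℕ} (A B C : Set (EuclideanSpace ℝ (Fin n))) (hA : IsCompact A)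
    (hB : IsCompact B) (hC : IsCompact C) (hCc : Convex ℝ C) (hA1 : volume A = 1)
    (hB1 : volume B = 1) (hC1 : volume C = 1)
    (H : ∀ x ∈ A, ∀ y ∈ B, (1 / 2 : ℝ) • x + (1 / 2 : ℝ) • y ∈ C)
    (u : EuclideanSpace ℝ (Fin n)) (hu : u ≠ 0) :
    ∃ d, ∀ s, volume.real (B ∩ {x | ⟪x, u⟫ ≤ s + d}) = volume.real (A ∩ {x | ⟪x, u⟫ ≤ s}) := by
  have pA := pushprob A hA1 u
  have pB := pushprob B hB1 u
  have pC := pushprob C hC1 u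
  have cI : ∀ s : ℝ, IsClosed {x : EuclideanSpace ℝ (Fin n) | ⟪x, u⟫ ≤ s} := fun s =>
    isClosed_le (by fun_prop) continuous_const
  have cI' : ∀ s : ℝ, IsClosed {x : EuclideanSpace ℝ (Fin n) | s ≤ ⟪x, u⟫} := fun s =>
    isClosed_le continuous_const (by fun_prop)
  have key := oneD _ _ _ (isCdf_of (push_null A u hu)) (isCdf_of (push_null B u hu))
    (isCdf_of (push_null C u hu)) ?_ ?_ ?_
  · obtain ⟨d, hd⟩ := key
    refine ⟨d, fun s => ?_⟩
    have := hd s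
    simp only [push_apply _ _ _ measurableSet_Iic] at this
    exact this
  · intro s t
    simp only [push_apply _ _ _ measurableSet_Iic, mem_Iic]
    refine bm_half _ _ _ (hA.inter_right (cI _)) (hB.inter_right (cI _)) (hC.inter_right (cI _)) ?_
    rintro x ⟨hx, hxs⟩ y ⟨hy, hyt⟩
    refine ⟨H x hx y hy, ?_⟩
    simp only [mem_ofPred_eq, inner_add_left, inner_smul_left, RCLike.conj_to_real] at *
    linarith
  · intro s t
    simp only [one_sub_cdf (push_null A u hu), one_sub_cdf (push_null B u hu),
      one_sub_cdf (push_null C u hu), push_apply _ _ _ measurableSet_Ici, mem_Ici]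
    refine bm_half _ _ _ (hA.inter_right (cI' _)) (hB.inter_right (cI' _))
      (hC.inter_right (cI' _)) ?_
    rintro x ⟨hx, hxs⟩ y ⟨hy, hyt⟩
    refine ⟨H x hx y hy, ?_⟩
    simp only [mem_ofPred_eq, inner_add_left, inner_smul_left, RCLike.conj_to_real] at *
    linarith
  · intro s t θ h0 h1
    simp only [push_apply _ _ _ measurableSet_Iic, mem_Iic]
    refine bm θ h0 h1 _ _ _ (hC.inter_right (cI _)) (hC.inter_right (cI _))
      (hC.inter_right (cI _)) ?_
    rintro x ⟨hx, hxs⟩ y ⟨hy, hyt⟩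
    refine ⟨hCc hx hy (by linarith) h0.le (by ring), ?_⟩
    simp only [mem_ofPred_eq, inner_add_left, inner_smul_left, RCLike.conj_to_real] at *
    have : 0 ≤ 1 - θ := by linarith
    gcongr

lemma dir_shift_eq {n : ℕ} (A B : Set (EuclideanSpace ℝ (Fin n))) (hA : IsCompact A)
    (hB : IsCompact B) (hA1 : volume A = 1) (hB1 : volume B = 1)
    (u : EuclideanSpace ℝ (Fin n)) (d : ℝ)
    (hd : ∀ s, volume.real (B ∩ {x | ⟪x, u⟫ ≤ s + d}) = volume.real (A ∩ {x | ⟪x, u⟫ ≤ s})) :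
    d = ⟪(∫ x in B, x) - ∫ x in A, x, u⟫ := by
  have pA := pushprob A hA1 u
  have pB := pushprob B hB1 u
  have hm : Measurable (fun x : EuclideanSpace ℝ (Fin n) => ⟪x, u⟫) := by fun_prop
  set μ := (volume.restrict A).map (fun x => ⟪x, u⟫) with hμ
  set ν := (volume.restrict B).map (fun x => ⟪x, u⟫) with hν
  have hmd : Measurable (fun t : ℝ => t + d) := by fun_prop
  have hpm : IsProbabilityMeasure (μ.map (fun t => t + d)) :=
    Measure.isProbabilityMeasure_map hmd.aemeasurable
  have hE : μ.map (fun t => t + d) = ν := by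
    refine Measure.ext_of_Iic _ _ fun a => ?_
    rw [← measureReal_eq_measureReal_iff, map_measureReal_apply hmd measurableSet_Iic]
    have : (fun t : ℝ => t + d) ⁻¹' Iic a = Iic (a - d) := by
      ext t; simp [le_sub_iff_add_le]
    rw [this, hμ, hν, push_apply _ _ _ measurableSet_Iic, push_apply _ _ _ measurableSet_Iic]
    have := hd (a - d)
    simp only [sub_add_cancel] at this
    exact this.symm
  have iA : IntegrableOn (fun x : EuclideanSpace ℝ (Fin n) => x) A :=
    continuous_id.continuousOn.integrableOn_compact hA
  have iB : IntegrableOn (fun x : EuclideanSpace ℝ (Fin n) => x) B :=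
    continuous_id.continuousOn.integrableOn_compact hB
  have iA' : IntegrableOn (fun x : EuclideanSpace ℝ (Fin n) => ⟪x, u⟫) A :=
    ContinuousOn.integrableOn_compact hA (by fun_prop)
  have e1 : ∫ t, t ∂ν = ∫ x in B, ⟪x, u⟫ := by
    rw [hν, integral_map hm.aemeasurable (by fun_prop)]
  have e2 : ∫ t, t ∂ν = (∫ x in A, ⟪x, u⟫) + d := by
    rw [← hE, integral_map hmd.aemeasurable (by fun_prop), hμ,
      integral_map hm.aemeasurable (by fun_prop), integral_add iA' (integrable_const_iff.2 (Or.inr ⟨by simp [hA1]⟩))]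
    simp [Measure.real, hA1]
  have e3 : ∀ S : Set (EuclideanSpace ℝ (Fin n)),
      IntegrableOn (fun x : EuclideanSpace ℝ (Fin n) => x) S →
      ∫ x in S, ⟪x, u⟫ = ⟪∫ x in S, x, u⟫ := by
    intro S hS
    rw [real_inner_comm, ← integral_inner hS]
    simp only [real_inner_comm]
  rw [inner_sub_left, ← e3 B iB, ← e3 A iA, ← e1, e2]
  ring

lemma vol_open_pos {n : ℕ} (B U : Set (EuclideanSpace ℝ (Fin n))) (hBc : Convex ℝ B)
    (hB : volume B ≠ 0) (hU : IsOpen U) (x : EuclideanSpace ℝ (Fin n)) (hx : x ∈ B) (hxU : x ∈ U) :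
    0 < volume (B ∩ U) := by
  have hint : (interior B).Nonempty := by
    by_contra hcon
    rw [not_nonempty_iff_eq_empty] at hcon
    apply hB
    have h1 : B ⊆ frontier B := by
      rw [frontier, hcon, sdiff_empty]; exact subset_closure
    exact measure_mono_null h1 (hBc.addHaar_frontier volume)
  have hcl : x ∈ closure (interior B) := by
    rw [hBc.closure_interior_eq_closure_of_nonempty_interior hint]; exact subset_closure hx
  obtain ⟨y, hyU, hyB⟩ := mem_closure_iff.1 hcl U hU hxU
  have : 0 < volume (U ∩ interior B) :=
    (hU.inter isOpen_interior).measure_pos _ ⟨y, hyU, hyB⟩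
  refine this.trans_le (measure_mono ?_)
  exact fun z hz => ⟨interior_subset hz.2, hz.1⟩

lemma half_incl {n : ℕ} (A B C : Set (EuclideanSpace ℝ (Fin n))) (hA : IsCompact A)
    (hB : IsCompact B) (hC : IsCompact C) (hAc : Convex ℝ A) (hBc : Convex ℝ B)
    (hCc : Convex ℝ C) (hA1 : volume A = 1)
    (hB1 : volume B = 1) (hC1 : volume C = 1)
    (H : ∀ x ∈ A, ∀ y ∈ B, (1 / 2 : ℝ) • x + (1 / 2 : ℝ) • y ∈ C) :
    ∀ y ∈ B, y - ((∫ x in B, x) - ∫ x in A, x) ∈ A := by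
  intro y hy
  set D := (∫ x in B, x) - ∫ x in A, x with hD
  by_contra hcon
  obtain ⟨f, c, hf1, hf2⟩ := geometric_hahn_banach_closed_point hAc hA.isClosed hcon
  set u := (InnerProductSpace.toDual ℝ (EuclideanSpace ℝ (Fin n))).symm f with hu
  have hfu : ∀ x, f x = ⟪x, u⟫ := by
    intro x
    rw [real_inner_comm, hu, InnerProductSpace.toDual_symm_apply]
  simp only [hfu] at hf1 hf2
  have hAne : A.Nonempty := by
    rw [nonempty_iff_ne_empty]; rintro rfl; simp at hA1
  have hu0 : u ≠ 0 := by
    intro h0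
    obtain ⟨a, ha⟩ := hAne
    have := hf1 a ha
    rw [h0] at this hf2
    simp at this hf2
    linarith
  obtain ⟨d, hd⟩ := dir_shift A B C hA hB hC hCc hA1 hB1 hC1 H u hu0
  have hdD := dir_shift_eq A B hA hB hA1 hB1 u d hd
  have hFA : A ∩ {x | ⟪x, u⟫ ≤ c} = A := by
    rw [inter_eq_left]; intro x hx; exact (hf1 x hx).le
  have h1 := hd c
  rw [hFA] at h1
  have hopen : IsOpen {x : EuclideanSpace ℝ (Fin n) | c + d < ⟪x, u⟫} :=
    isOpen_lt continuous_const (by fun_prop)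
  have hpos := vol_open_pos B {x | c + d < ⟪x, u⟫} hBc (by simp [hB1]) hopen y hy (by
    rw [inner_sub_left, ← hdD] at hf2
    simp only [mem_ofPred_eq]; linarith)
  have hsplit := measure_inter_add_sdiff (μ := volume) B
    (isClosed_le (by fun_prop) continuous_const :
      IsClosed {x : EuclideanSpace ℝ (Fin n) | ⟪x, u⟫ ≤ c + d}).measurableSet
  have hdiff : B \ {x | ⟪x, u⟫ ≤ c + d} = B ∩ {x | c + d < ⟪x, u⟫} := by
    ext x; simp
  have hone : volume (B ∩ {x | ⟪x, u⟫ ≤ c + d}) = 1 := by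
    have : volume.real A = 1 := by simp [Measure.real, hA1]
    rw [this, Measure.real] at h1
    rwa [ENNReal.toReal_eq_one_iff] at h1
  rw [hdiff, hone, hB1] at hsplit
  have : volume (B ∩ {x | c + d < ⟪x, u⟫}) = 0 := by
    have h5 : (1 : ℝ≥0∞) + volume (B ∩ {x | c + d < ⟪x, u⟫}) = 1 + 0 := by simpa using hsplit
    exact (ENNReal.add_right_inj ENNReal.one_ne_top).1 h5
  exact hpos.ne' this

lemma half_eq {n : ℕ} (A B C : Set (EuclideanSpace ℝ (Fin n))) (hA : IsCompact A)
    (hB : IsCompact B) (hC : IsCompact C) (hAc : Convex ℝ A) (hBc : Convex ℝ B)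
    (hCc : Convex ℝ C) (hA1 : volume A = 1)
    (hB1 : volume B = 1) (hC1 : volume C = 1)
    (H : ∀ x ∈ A, ∀ y ∈ B, (1 / 2 : ℝ) • x + (1 / 2 : ℝ) • y ∈ C) :
    ∃ d, B = A + {d} := by
  refine ⟨(∫ x in B, x) - ∫ x in A, x, ?_⟩
  have i1 := half_incl A B C hA hB hC hAc hBc hCc hA1 hB1 hC1 H
  have i2 := half_incl B A C hB hA hC hBc hAc hCc hB1 hA1 hC1
    (fun x hx y hy => by rw [add_comm]; exact H y hy x hx)
  ext y
  simp only [add_singleton, mem_image]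
  constructor
  · intro hy
    exact ⟨_, i1 y hy, by abel⟩
  · rintro ⟨x, hx, rfl⟩
    convert i2 x hx using 1
    abel

/-- Passing from equality at one weight to equality at weight one half. -/
lemma mid_le {n : ℕ} (A B C M : Set (EuclideanSpace ℝ (Fin n))) (hA : IsCompact A)
    (hC : IsCompact C) (hM : IsCompact M)
    (hAc : Convex ℝ A) (hA1 : volume A = 1) (hC1 : volume C = 1) (θ : ℝ) (h0 : 0 < θ)
    (h2 : θ ≤ 1 / 2)
    (hMe : M = (1 / 2 : ℝ) • A + (1 / 2 : ℝ) • B) (hCe : C = (1 - θ) • A + θ • B) :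
    volume M ≤ 1 := by
  rcases h2.eq_or_lt with h | h
  · subst h
    have : (1 - 1 / 2 : ℝ) = 1 / 2 := by norm_num
    rw [this] at hCe
    rw [hMe, ← hCe, hC1]
  have key := bm (2 * θ) (by linarith) (by linarith) A M C hA hM hC (by
    rintro a ha m hm
    rw [hMe] at hm
    obtain ⟨_, ⟨a', ha', rfl⟩, _, ⟨b, hb, rfl⟩, rfl⟩ := hm
    have h1 : 0 < 1 - θ := by linarith
    rw [hCe]
    refine ⟨_, ⟨((1 - 2 * θ) / (1 - θ)) • a + (θ / (1 - θ)) • a', ?_, rfl⟩, _, ⟨b, hb, rfl⟩, ?_⟩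
    · refine hAc ha ha' (div_nonneg (by linarith) h1.le) (div_nonneg h0.le h1.le) ?_
      field_simp; ring
    · simp only [smul_add, smul_smul]
      rw [mul_div_cancel₀ _ h1.ne', mul_div_cancel₀ _ h1.ne', add_assoc]
      congr 3 <;> ring)
  have r1 : volume.real A = 1 := by simp [Measure.real, hA1]
  have r2 : volume.real C = 1 := by simp [Measure.real, hC1]
  rw [r1, r2, Real.one_rpow, one_mul] at key
  have : volume.real M ≤ 1 := by
    by_contra hcon
    have := Real.one_lt_rpow (not_le.1 hcon) (show 0 < 2 * θ by linarith)
    linarith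
  rw [← ENNReal.ofReal_toReal hM.measure_ne_top]
  simpa [Measure.real] using this

lemma main_norm {n : ℕ} (A B : Set (EuclideanSpace ℝ (Fin n))) (hA : IsCompact A)
    (hB : IsCompact B) (hAc : Convex ℝ A) (hBc : Convex ℝ B) (hA1 : volume A = 1)
    (hB1 : volume B = 1) (θ : ℝ) (h0 : 0 < θ) (h1 : θ < 1)
    (hC1 : volume ((1 - θ) • A + θ • B) = 1) : ∃ d, B = A + {d} := by
  have hM : IsCompact ((1 / 2 : ℝ) • A + (1 / 2 : ℝ) • B) := (hA.smul _).add (hB.smul _)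
  have hC : IsCompact ((1 - θ) • A + θ • B) := (hA.smul _).add (hB.smul _)
  have hMem : ∀ x ∈ A, ∀ y ∈ B,
      (1 / 2 : ℝ) • x + (1 / 2 : ℝ) • y ∈ (1 / 2 : ℝ) • A + (1 / 2 : ℝ) • B :=
    fun x hx y hy => add_mem_add (smul_mem_smul_set hx) (smul_mem_smul_set hy)
  have hle : volume ((1 / 2 : ℝ) • A + (1 / 2 : ℝ) • B) ≤ 1 := by
    rcases le_total θ (1 / 2) with h | h
    · exact mid_le A B _ _ hA hC hM hAc hA1 hC1 θ h0 h rfl rfl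
    · refine mid_le B A _ _ hB hC hM hBc hB1 hC1 (1 - θ) (by linarith) (by linarith)
        (add_comm _ _) ?_
      rw [add_comm, sub_sub_cancel]
  have hge : 1 ≤ volume ((1 / 2 : ℝ) • A + (1 / 2 : ℝ) • B) := by
    have := bm_half A B _ hA hB hM hMem
    simp only [Measure.real, hA1, hB1, ENNReal.toReal_one, one_mul] at this
    have h3 := (one_le_sq_iff₀ ENNReal.toReal_nonneg).1 this
    rw [← ENNReal.ofReal_toReal hM.measure_ne_top]
    simpa using h3
  exact half_eq A B _ hA hB hM hAc hBc ((hAc.smul _).add (hBc.smul _)) hA1 hB1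
    (le_antisymm hle hge) hMem

/-- Equality case of the Brunn–Minkowski inequality: convex bodies of positive volume
with `|A+B|^{1/n} = |A|^{1/n} + |B|^{1/n}` are homothetic. -/
theorem brunn_minkowski_equality_case {n : ℕ}
    (A B : ConvexBody (EuclideanSpace ℝ (Fin n)))
    (hA : 0 < volume (A : Set (EuclideanSpace ℝ (Fin n))))
    (hB : 0 < volume (B : Set (EuclideanSpace ℝ (Fin n))))
    (heq : (volume ((A : Set (EuclideanSpace ℝ (Fin n)))
        + (B : Set (EuclideanSpace ℝ (Fin n))))).toReal ^ ((1 : ℝ) / n)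
      = (volume (A : Set (EuclideanSpace ℝ (Fin n)))).toReal ^ ((1 : ℝ) / n)
        + (volume (B : Set (EuclideanSpace ℝ (Fin n)))).toReal ^ ((1 : ℝ) / n)) :
    ∃ (c : ℝ) (d : EuclideanSpace ℝ (Fin n)), 0 < c ∧
      (B : Set (EuclideanSpace ℝ (Fin n)))
        = c • (A : Set (EuclideanSpace ℝ (Fin n))) + {d} := by
  rcases Nat.eq_zero_or_pos n with hn | hn
  · exfalso
    subst hn
    norm_num at heq
  have hAk := A.isCompact
  have hBk := B.isCompact
  have hAc := A.convex
  have hBc := B.convex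
  generalize (A : Set (EuclideanSpace ℝ (Fin n))) = A at *
  generalize (B : Set (EuclideanSpace ℝ (Fin n))) = B at *
  have hn' : (n : ℝ) ≠ 0 := by positivity
  have hSk : IsCompact (A + B) := hAk.add hBk
  have hvA : 0 < (volume A).toReal := ENNReal.toReal_pos hA.ne' hAk.measure_ne_top
  have hvB : 0 < (volume B).toReal := ENNReal.toReal_pos hB.ne' hBk.measure_ne_top
  set a := (volume A).toReal ^ ((1 : ℝ) / n) with ha
  set b := (volume B).toReal ^ ((1 : ℝ) / n) with hb
  have ha0 : 0 < a := Real.rpow_pos_of_pos hvA _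
  have hb0 : 0 < b := Real.rpow_pos_of_pos hvB _
  have norm1 : ∀ (S : Set (EuclideanSpace ℝ (Fin n))) (r : ℝ), 0 < r → volume S ≠ ⊤ →
      (volume S).toReal ^ ((1 : ℝ) / n) = r → volume (r⁻¹ • S) = 1 := by
    intro S r hr hS hSr
    have hpow : r ^ n = (volume S).toReal := by
      rw [← hSr, ← Real.rpow_natCast, ← Real.rpow_mul ENNReal.toReal_nonneg,
        one_div_mul_cancel hn', Real.rpow_one]
    rw [Measure.addHaar_smul, finrank_euclideanSpace_fin, ← ENNReal.ofReal_toReal hS, ← hpow,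
      ← ENNReal.ofReal_mul (abs_nonneg _), abs_of_pos (by positivity), ← mul_pow,
      inv_mul_cancel₀ hr.ne']
    simp
  have hab : 0 < a + b := by positivity
  have key := main_norm (a⁻¹ • A) (b⁻¹ • B) (hAk.smul _) (hBk.smul _) (hAc.smul _) (hBc.smul _)
    (norm1 A a ha0 hAk.measure_ne_top rfl) (norm1 B b hb0 hBk.measure_ne_top rfl)
    (b / (a + b)) (by positivity) (by rw [div_lt_one hab]; linarith) (by
      have := norm1 (A + B) (a + b) hab hSk.measure_ne_top heq
      rw [smul_add] at this
      rw [smul_smul, smul_smul]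
      convert this using 4 <;> field_simp
      ring)
  obtain ⟨d, hd⟩ := key
  refine ⟨b / a, b • d, by positivity, ?_⟩
  have h2 : b • (b⁻¹ • B) = b • (a⁻¹ • A + {d}) := by rw [hd]
  rw [smul_smul, mul_inv_cancel₀ hb0.ne', one_smul, smul_add, smul_smul, smul_set_singleton] at h2
  rw [div_eq_mul_inv]
  exact h2
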